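/- Let X be a partial EFX allocation for n agents whose valuations are non-degenerate and cancelable, in which at least n−1 items are unallocated. Then there exists a partial EFX allocation Y that Pareto dominates X. -/

import Mathlib

namespace FairDivision

open Finset

/-- A valuation: nonnegative, zero on the empty set, monotone. -/
def IsValuation {ι : Type*} (v : Finset ι → ℝ) : Prop :=
  v ∅ = 0 ∧ (∀ S : Finset ι, 0 ≤ v S) ∧ ∀ ⦃S T : Finset ι⦄, S ⊆ T → v S ≤ v T

/-- `v` is cancelable: `v (S ∪ {g}) > v (T ∪ {g})` implies `v S > v T`. -/
def Cancelable {ι : Type*} [DecidableEq ι] (v : Finset ι → ℝ) : Prop :=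
  ∀ S T : Finset ι, ∀ g : ι, g ∉ S → g ∉ T →
    v (insert g S) > v (insert g T) → v S > v T

/-- `v` is non-degenerate: distinct bundles have distinct values. -/
def NonDegenerate {ι : Type*} (v : Finset ι → ℝ) : Prop :=
  ∀ S T : Finset ι, S ≠ T → v S ≠ v T

/-- `v'` respects `v`: every strict inequality of `v` is a strict inequality of `v'`. -/
def Respects {ι : Type*} (v' v : Finset ι → ℝ) : Prop :=
  ∀ S T : Finset ι, v S > v T → v' S > v' T

/-- `v` is a nice cancelable valuation: cancelable, and some non-degenerate
cancelable valuation respects it. -/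
def NiceCancelable {ι : Type*} [DecidableEq ι] (v : Finset ι → ℝ) : Prop :=
  Cancelable v ∧ ∃ v' : Finset ι → ℝ,
    IsValuation v' ∧ NonDegenerate v' ∧ Cancelable v' ∧ Respects v' v

/-- A partial allocation: the bundles are pairwise disjoint. -/
def IsPartialAlloc {ι : Type*} {n : ℕ} (X : Fin n → Finset ι) : Prop :=
  ∀ i j : Fin n, i ≠ j → Disjoint (X i) (X j)

/-- The set of unallocated items. -/
def unalloc {ι : Type*} [DecidableEq ι] [Fintype ι] {n : ℕ}
    (X : Fin n → Finset ι) : Finset ι :=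
  Finset.univ \ Finset.univ.biUnion X

/-- Agent `i` envies the set `S`. -/
def EnviesSet {ι : Type*} {n : ℕ} (v : Fin n → Finset ι → ℝ) (X : Fin n → Finset ι)
    (i : Fin n) (S : Finset ι) : Prop :=
  v i (X i) < v i S

/-- Agent `i` strongly envies the set `S`. -/
def StrongEnviesSet {ι : Type*} [DecidableEq ι] {n : ℕ} (v : Fin n → Finset ι → ℝ)
    (X : Fin n → Finset ι) (i : Fin n) (S : Finset ι) : Prop :=
  ∃ h ∈ S, v i (X i) < v i (S.erase h)

/-- The allocation is EFX: no agent strongly envies another agent's bundle. -/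
def IsEFX {ι : Type*} [DecidableEq ι] {n : ℕ} (v : Fin n → Finset ι → ℝ)
    (X : Fin n → Finset ι) : Prop :=
  ∀ i j : Fin n, i ≠ j → ¬ StrongEnviesSet v X i (X j)

/-- `Y` Pareto dominates `X`. -/
def ParetoDominates {ι : Type*} {n : ℕ} (v : Fin n → Finset ι → ℝ)
    (Y X : Fin n → Finset ι) : Prop :=
  (∀ i, v i (X i) ≤ v i (Y i)) ∧ ∃ i, v i (X i) < v i (Y i)

/-- `Y` dominates `X` lexicographically with respect to the ordering `a` of the agents. -/
def Dominates {ι : Type*} {n : ℕ} (v : Fin n → Finset ι → ℝ) (a : Fin n → Fin n)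
    (Y X : Fin n → Finset ι) : Prop :=
  ∃ k : Fin n, (∀ j : Fin n, j < k → v (a j) (Y (a j)) = v (a j) (X (a j))) ∧
    v (a k) (X (a k)) < v (a k) (Y (a k))

/-- Agent `i` is a most envious agent of the set `S`: there is `T ⊆ S` that `i`
envies and that no agent strongly envies.  (`S \ T` is a corresponding discard set.) -/
def MostEnvious {ι : Type*} [DecidableEq ι] {n : ℕ} (v : Fin n → Finset ι → ℝ)
    (X : Fin n → Finset ι) (i : Fin n) (S : Finset ι) : Prop :=
  ∃ T ⊆ S, EnviesSet v X i T ∧ ∀ j : Fin n, ¬ StrongEnviesSet v X j T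

/-- `i` champions `j` with respect to the item `g`:  `i` is a most envious agent
of `X j ∪ {g}`. -/
def ChampG {ι : Type*} [DecidableEq ι] {n : ℕ} (v : Fin n → Finset ι → ℝ)
    (X : Fin n → Finset ι) (g : ι) (i j : Fin n) : Prop :=
  MostEnvious v X i (insert g (X j))

/-- `i` champions `j` with respect to `(H | S)`:  `H ⊆ M \ X j`, `S ⊆ X j`, and `i`
is a most envious agent of `(X j \ S) ∪ H`. -/
def GenChamp {ι : Type*} [DecidableEq ι] {n : ℕ} (v : Fin n → Finset ι → ℝ)
    (X : Fin n → Finset ι) (i j : Fin n) (H S : Finset ι) : Prop :=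
  Disjoint H (X j) ∧ S ⊆ X j ∧ MostEnvious v X i ((X j \ S) ∪ H)

/-- A set with at least `N > 0` elements contains the values of an `N`-periodic sequence
without other repetitions. -/
lemma exists_periodic_enumeration {α : Type*} {U : Finset α} {N : ℕ} (hN : 0 < N) (hU : N ≤ U.card) :
    ∃ E : ℕ → α, (∀ t, E t ∈ U) ∧ Function.Periodic E N ∧
      ∀ s t, s < t → t < s + N → E s ≠ E t := by
  obtain ⟨V, hVU, hV⟩ := exists_subset_card_eq hU
  let e := (V.equivFinOfCardEq hV).symm
  refine ⟨fun t => e ⟨t % N, Nat.mod_lt _ hN⟩, fun t => hVU (e _).2, fun t => by simp, ?_⟩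
  intro s t h1 h2 h
  have h3 : s % N = t % N := by simpa using e.injective (Subtype.ext h)
  have h4 : N ∣ t - s := (Nat.modEq_iff_dvd' h1.le).1 h3
  have := Nat.le_of_dvd (by omega) h4
  omega

section Helpers

variable {ι : Type*} [DecidableEq ι] {n : ℕ}
  {v : Fin n → Finset ι → ℝ} {X : Fin n → Finset ι}

/-- Some EFX partial allocation Pareto dominates `X`. -/
def Improvable (v : Fin n → Finset ι → ℝ) (X : Fin n → Finset ι) : Prop :=
  ∃ Y : Fin n → Finset ι, IsPartialAlloc Y ∧ IsEFX v Y ∧ ParetoDominates v Y X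

/-- A common part can be cancelled from a strict inequality. -/
lemma Cancelable.lt_of_union_lt {w : Finset ι → ℝ} (hw : Cancelable w) {S T : Finset ι} :
    ∀ D : Finset ι, Disjoint D S → Disjoint D T → w (D ∪ S) < w (D ∪ T) → w S < w T := by
  intro D
  induction D using Finset.induction_on with
  | empty => simp
  | insert a D ha ih =>
    intro hS hT h
    rw [disjoint_insert_left] at hS hT
    rw [insert_union, insert_union] at h
    exact ih hS.2 hT.2 (hw (D ∪ T) (D ∪ S) a (by simp [ha, hT.1]) (by simp [ha, hS.1]) h)

/-- A common part can be added to an inequality. -/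
lemma Cancelable.union_le_union {w : Finset ι → ℝ} (hw : Cancelable w) {S T : Finset ι}
    (D : Finset ι) (hS : Disjoint D S) (hT : Disjoint D T) (h : w S ≤ w T) :
    w (D ∪ S) ≤ w (D ∪ T) :=
  le_of_not_gt fun h' => absurd (hw.lt_of_union_lt D hT hS h') (not_lt.2 h)

/-- Every envied set has a most envious agent. -/
lemma EnviesSet.exists_mostEnvious {i : Fin n} {S : Finset ι} (h : EnviesSet v X i S) :
    ∃ k, MostEnvious v X k S := by
  classical
  have hne : (S.powerset.filter fun T => ∃ k, EnviesSet v X k T).Nonempty :=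
    ⟨S, by simpa using ⟨i, h⟩⟩
  obtain ⟨T, hT, hmin⟩ := exists_min_image _ Finset.card hne
  simp only [mem_filter, mem_powerset] at hT hmin
  obtain ⟨hTS, k, hk⟩ := hT
  refine ⟨k, T, hTS, hk, fun j ⟨x, hx, hj⟩ => ?_⟩
  have := hmin (T.erase x) ⟨(erase_subset _ _).trans hTS, j, hj⟩
  exact absurd (card_erase_lt_of_mem hx) (not_lt.2 this)

lemma IsEFX.not_strongEnviesSet (hEFX : IsEFX v X) (hval : ∀ i, IsValuation (v i))
    (i j : Fin n) : ¬ StrongEnviesSet v X i (X j) := by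
  rcases eq_or_ne i j with rfl | hij
  · rintro ⟨x, -, hx⟩
    exact absurd ((hval i).2.2 (erase_subset x (X i))) (not_le.2 hx)
  · exact hEFX i j hij

/-- Rotating suitable bundles along a cycle of agents yields a Pareto improvement. -/
lemma improvable_of_cycle (hval : ∀ i, IsValuation (v i)) (hX : IsPartialAlloc X)
    (hEFX : IsEFX v X) {s r : ℕ} (hsr : s ≤ r) (p : ℕ → Fin n) (Z : ℕ → Finset ι)
    (hp : Set.InjOn p (Set.Icc s r))
    (hstep : ∀ u, s ≤ u → u < r → MostEnvious v X (p (u + 1)) (Z u))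
    (hlast : MostEnvious v X (p s) (Z r))
    (hZ : ∀ u w, s ≤ u → u < w → w ≤ r → Disjoint (Z u) (Z w))
    (hZX : ∀ u i, s ≤ u → u ≤ r → (∀ w, s ≤ w → w ≤ r → p w ≠ i) → Disjoint (Z u) (X i)) :
    Improvable v X := by
  classical
  let q : ℕ → Fin n := fun u => if u = r then p s else p (u + 1)
  have hq : ∀ u, s ≤ u → u ≤ r → MostEnvious v X (q u) (Z u) := by
    intro u h1 h2
    by_cases h : u = r
    · simpa [q, h] using hlast
    · simpa [q, h] using hstep u h1 (by omega)
  have hqinj : ∀ u w, s ≤ u → u ≤ r → s ≤ w → w ≤ r → q u = q w → u = w := by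
    intro u w h1 h2 h3 h4 h
    by_cases hu : u = r <;> by_cases hw : w = r <;> simp only [q, hu, hw, if_true, if_false] at h
    · omega
    · have := hp ⟨le_refl s, hsr⟩ (⟨by omega, by omega⟩ : w + 1 ∈ Set.Icc s r) h
      omega
    · have := hp (⟨by omega, by omega⟩ : u + 1 ∈ Set.Icc s r) ⟨le_refl s, hsr⟩ h
      omega
    · have := hp (⟨by omega, by omega⟩ : u + 1 ∈ Set.Icc s r)
        (⟨by omega, by omega⟩ : w + 1 ∈ Set.Icc s r) h
      omega
  have hqp : ∀ w, s ≤ w → w ≤ r → ∃ u, s ≤ u ∧ u ≤ r ∧ q u = p w := by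
    intro w h1 h2
    by_cases hw : w = s
    · exact ⟨r, hsr, le_refl r, by simp [q, hw]⟩
    · refine ⟨w - 1, by omega, by omega, ?_⟩
      have h3 : w - 1 ≠ r := by omega
      have h4 : w - 1 + 1 = w := by omega
      simp [q, h3, h4]
  choose! T hTZ hTe hTn using hq
  let P : Fin n → Finset ι → Prop := fun i S =>
    (∃ u, s ≤ u ∧ u ≤ r ∧ q u = i ∧ S = T u) ∨ ((∀ u, s ≤ u → u ≤ r → q u ≠ i) ∧ S = X i)
  have hP : ∀ i, ∃ S, P i S := by
    intro i
    by_cases h : ∃ u, s ≤ u ∧ u ≤ r ∧ q u = i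
    · obtain ⟨u, h1, h2, h3⟩ := h
      exact ⟨T u, Or.inl ⟨u, h1, h2, h3, rfl⟩⟩
    · push Not at h
      exact ⟨X i, Or.inr ⟨h, rfl⟩⟩
  choose Y hY using hP
  have hle : ∀ i, v i (X i) ≤ v i (Y i) := by
    intro i
    rcases hY i with ⟨u, h1, h2, rfl, h3⟩ | ⟨-, h⟩
    · rw [h3]
      exact (hTe u h1 h2).le
    · rw [h]
  have hTX : ∀ u i, s ≤ u → u ≤ r → (∀ w, s ≤ w → w ≤ r → q w ≠ i) → Disjoint (T u) (X i) := by
    intro u i h1 h2 h3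
    refine (hZX u i h1 h2 fun w hw1 hw2 hw => ?_).mono_left (hTZ u h1 h2)
    obtain ⟨w', a, b, c⟩ := hqp w hw1 hw2
    exact h3 w' a b (c.trans hw)
  refine ⟨Y, ?_, ?_, hle, ?_⟩
  · intro i j hij
    rcases hY i with ⟨u, h1, h2, rfl, h3⟩ | ⟨h, h3⟩ <;>
      rcases hY j with ⟨w, h4, h5, rfl, h6⟩ | ⟨h', h6⟩ <;> rw [h3, h6]
    · have huw : u ≠ w := fun h => hij (by rw [h])
      rcases lt_or_gt_of_ne huw with h | h
      · exact (hZ u w h1 h h5).mono (hTZ u h1 h2) (hTZ w h4 h5)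
      · exact (hZ w u h4 h h2).symm.mono (hTZ u h1 h2) (hTZ w h4 h5)
    · exact hTX u j h1 h2 h'
    · exact (hTX w i h4 h5 h).symm
    · exact hX i j hij
  · rintro i j - ⟨x, hx, hlt⟩
    have hlt' := (hle i).trans_lt hlt
    rcases hY j with ⟨u, h1, h2, rfl, h3⟩ | ⟨-, h⟩
    · rw [h3] at hx hlt'
      exact hTn u h1 h2 i ⟨x, hx, hlt'⟩
    · rw [h] at hx hlt'
      exact hEFX.not_strongEnviesSet hval i j ⟨x, hx, hlt'⟩
  · refine ⟨q s, ?_⟩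
    rcases hY (q s) with ⟨u, h1, h2, h3, h4⟩ | ⟨h, -⟩
    · have := hqinj _ _ h1 h2 le_rfl hsr h3
      subst this
      rw [h4]
      exact hTe u h1 h2
    · exact absurd rfl (h s le_rfl hsr)

variable [Fintype ι]

lemma notMem_of_mem_unalloc {g : ι} (hg : g ∈ unalloc X) (i : Fin n) : g ∉ X i := by
  simp only [unalloc, mem_sdiff, mem_univ, mem_biUnion, true_and, not_exists] at hg
  exact hg i

/-- If `X` is not improvable, then walks in the champion graph that use disjoint sets of
unallocated items do not revisit any agent. -/
lemma walk_injOn (hval : ∀ i, IsValuation (v i)) (hX : IsPartialAlloc X)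
    (hEFX : IsEFX v X) (hno : ¬ Improvable v X) (p : ℕ → Fin n) (G : ℕ → Finset ι) :
    ∀ m : ℕ, (∀ t < m, G t ⊆ unalloc X) → (∀ t u, t < u → u < m → Disjoint (G t) (G u)) →
      (∀ t < m, MostEnvious v X (p (t + 1)) (G t ∪ X (p t))) → Set.InjOn p (Set.Icc 0 m) := by
  intro m
  induction m with
  | zero => intros; simp
  | succ m ih =>
    intro hGU hG hstep
    have ih' := ih (fun t ht => hGU t (by omega)) (fun t u h1 h2 => hG t u h1 (by omega))
      (fun t ht => hstep t (by omega))
    have hnew : ∀ s ≤ m, p s ≠ p (m + 1) := by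
      intro s hs heq
      have hXG : ∀ i u, u ≤ m → Disjoint (G u) (X i) := fun i u hu =>
        disjoint_left.2 fun x hx => notMem_of_mem_unalloc (hGU u (by omega) hx) i
      have hpinj : Set.InjOn p (Set.Icc s m) := ih'.mono (Set.Icc_subset_Icc_left (Nat.zero_le s))
      refine hno (improvable_of_cycle hval hX hEFX hs p (fun u => G u ∪ X (p u)) hpinj
        (fun u _ h => hstep u (by omega)) (heq ▸ hstep m (by omega)) ?_ ?_)
      · intro u w h1 h2 h3
        have hne : p u ≠ p w := fun h => by
          have := hpinj ⟨h1, by omega⟩ ⟨by omega, h3⟩ h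
          omega
        simp only [disjoint_union_left, disjoint_union_right]
        exact ⟨⟨hG u w h2 (by omega), (hXG _ w h3).symm⟩, hXG _ u (by omega), hX _ _ hne⟩
      · intro u i h1 h2 h3
        exact disjoint_union_left.2 ⟨hXG i u h2, hX _ _ (h3 u h1 h2)⟩
    intro s hs t ht hst
    rcases Nat.lt_or_ge m s with h1 | h1 <;> rcases Nat.lt_or_ge m t with h2 | h2
    · have := hs.2
      have := ht.2
      omega
    · have : s = m + 1 := le_antisymm hs.2 h1
      exact absurd (hst.symm.trans (by rw [this])) (hnew t h2)
    · have : t = m + 1 := le_antisymm ht.2 h2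
      exact absurd (hst.trans (by rw [this])) (hnew s h1)
    · exact ih' ⟨hs.1, h1⟩ ⟨ht.1, h2⟩ hst

end Helpers

lemma exists_eq_of_injOn_window {N : ℕ} {p : ℕ → Fin (N + 1)} {s : ℕ}
    (hp : Set.InjOn p (Set.Icc s (s + N))) (i : Fin (N + 1)) :
    ∃ u, s ≤ u ∧ u ≤ s + N ∧ p u = i := by
  have hinj : Function.Injective fun t : Fin (N + 1) => p (s + t) := by
    intro a b hab
    have ha := a.2
    have hb := b.2
    have := hp ⟨by omega, by omega⟩ ⟨by omega, by omega⟩ hab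
    exact Fin.ext (by omega)
  obtain ⟨t, ht⟩ := Finite.surjective_of_injective hinj i
  have := t.2
  exact ⟨s + t, by omega, by omega, ht⟩

section Cyclic

variable {ι : Type*} [DecidableEq ι] [Fintype ι] {N : ℕ}
  {v : Fin (N + 1) → Finset ι → ℝ} {X : Fin (N + 1) → Finset ι}

/-- If `X` is not improvable and `N` items are unallocated, then nobody envies anybody and
the agents lie on a cycle on which every agent is the unique champion of its predecessor,
whichever of these `N` items is used. -/
lemma exists_champion_cycle (hN : 0 < N) (hval : ∀ i, IsValuation (v i))
    (hnd : ∀ i, NonDegenerate (v i)) (hX : IsPartialAlloc X) (hEFX : IsEFX v X)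
    (hU : N ≤ (unalloc X).card) (hno : ¬ Improvable v X) :
    ∃ (E : ℕ → ι) (p : ℕ → Fin (N + 1)), (∀ t, E t ∈ unalloc X) ∧
      (∀ s t, s < t → t < s + N → E s ≠ E t) ∧
      (∀ s, Set.InjOn p (Set.Icc s (s + N))) ∧ Function.Periodic p (N + 1) ∧
      (∀ u b, ChampG v X (E b) (p (u + 1)) (p u)) ∧
      (∀ u b k, ChampG v X (E b) k (p u) → k = p (u + 1)) ∧
      ∀ i j, ¬ EnviesSet v X i (X j) := by
  obtain ⟨E, hEU, hEper, hE⟩ := exists_periodic_enumeration hN hU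
  have hchamp : ∀ b j, ∃ k, ChampG v X (E b) k j := by
    intro b j
    refine EnviesSet.exists_mostEnvious (i := j) (lt_of_le_of_ne ?_ ?_)
    · exact (hval j).2.2 (subset_insert _ _)
    · exact hnd j _ _ fun h => notMem_of_mem_unalloc (hEU b) j (h ▸ mem_insert_self _ _)
  choose f hf using hchamp
  let p : ℕ → Fin (N + 1) := fun t => Nat.rec 0 (fun t i => f t i) t
  have hp : ∀ t, ChampG v X (E t) (p (t + 1)) (p t) := fun t => hf t (p t)
  have hsing : ∀ b, {E b} ⊆ unalloc X := fun b => singleton_subset_iff.2 (hEU b)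
  have hinj : ∀ s, Set.InjOn p (Set.Icc s (s + N)) := by
    intro s a ha b hb hab
    have := walk_injOn hval hX hEFX hno (fun t => p (s + t)) (fun t => {E (s + t)}) N
      (fun t _ => hsing _)
      (fun t u h1 h2 => disjoint_singleton.2 (hE _ _ (by omega) (by omega)))
      (fun t _ => hp (s + t))
      (x₁ := a - s) (x₂ := b - s) ⟨by omega, by have := ha.2; omega⟩
      ⟨by omega, by have := hb.2; omega⟩
      (by simpa [Nat.add_sub_cancel' ha.1, Nat.add_sub_cancel' hb.1] using hab)
    have := ha.1
    have := hb.1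
    omega
  have hper : Function.Periodic p (N + 1) := by
    intro s
    obtain ⟨u, h1, h2, h3⟩ := exists_eq_of_injOn_window (hinj s) (p (s + (N + 1)))
    rcases h1.eq_or_lt with rfl | h1
    · exact h3.symm
    · have := hinj (s + 1) (x₂ := s + (N + 1)) ⟨h1, by omega⟩ ⟨by omega, by omega⟩ h3
      omega
  have hall : ∀ u b, ChampG v X (E b) (p (u + 1)) (p u) := by
    intro u b
    obtain ⟨M, rfl⟩ : ∃ M, N = M + 1 := ⟨N - 1, by omega⟩
    have h := hp (u + (b + M * u) * (M + 1 + 1))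
    have h1 : p (u + (b + M * u) * (M + 1 + 1)) = p u := by
      simpa using hper.nat_mul (b + M * u) u
    have h2 : p (u + (b + M * u) * (M + 1 + 1) + 1) = p (u + 1) := by
      rw [add_right_comm u]
      simpa using hper.nat_mul (b + M * u) (u + 1)
    have h3 : E (u + (b + M * u) * (M + 1 + 1)) = E b := by
      rw [show u + (b + M * u) * (M + 1 + 1) = b + (u + b + M * u) * (M + 1) by ring]
      simpa using hEper.nat_mul (u + b + M * u) b
    rwa [h1, h2, h3] at h
  refine ⟨E, p, hEU, hE, hinj, hper, hall, ?_, ?_⟩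
  · intro u b k hk
    let P : ℕ → Fin (N + 1) := fun t => if t = N then k else p (u + 2 + t)
    have hPinj := walk_injOn hval hX hEFX hno P (fun t => {E (b + 1 + t)}) N
      (fun t _ => hsing _)
      (fun t w h1 h2 => disjoint_singleton.2 (hE _ _ (by omega) (by omega)))
      (by
        intro t ht
        by_cases h : t + 1 = N
        · have h1 : P (t + 1) = k := by simp [P, h]
          have h2 : P t = p u := by
            have : u + 2 + t = u + (N + 1) := by omega
            simp only [P, ht.ne, if_false, this, hper u]
          have h3 : E (b + 1 + t) = E b := by
            rw [show b + 1 + t = b + N by omega, hEper b]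
          simp only [h1, h2, h3]
          exact hk
        · simp only [P, h, ht.ne, if_false]
          exact hall (u + 2 + t) _)
    obtain ⟨w, h1, h2, h3⟩ := exists_eq_of_injOn_window (hinj (u + 1)) k
    rcases h1.eq_or_lt with rfl | h1
    · exact h3.symm
    · have h4 : w - (u + 2) ≠ N := by omega
      have h5 : u + 2 + (w - (u + 2)) = w := by omega
      exact absurd (hPinj ⟨Nat.zero_le _, by omega⟩ ⟨Nat.zero_le N, le_rfl⟩
        (by simp [P, h4, h5, h3])) h4
  · intro i j hij
    obtain ⟨u, -, -, rfl⟩ := exists_eq_of_injOn_window (hinj 0) i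
    have henv : MostEnvious v X (p u) (X j) :=
      ⟨X j, subset_rfl, hij, fun k => hEFX.not_strongEnviesSet hval k j⟩
    let P : ℕ → Fin (N + 1) := fun t => Nat.casesOn t j fun t => p (u + t)
    let G : ℕ → Finset ι := fun t => Nat.casesOn t ∅ fun t => {E t}
    have hPinj := walk_injOn hval hX hEFX hno P G (N + 1)
      (by
        rintro (_ | t) ht
        · exact empty_subset _
        · exact hsing t)
      (by
        rintro (_ | t) (_ | w) h1 h2
        · omega
        · exact disjoint_empty_left _
        · omega
        · exact disjoint_singleton.2 (hE _ _ (by omega) (by omega)))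
      (by
        rintro (_ | t) ht
        · simpa [P, G] using henv
        · exact hall (u + t) t)
    obtain ⟨w, h1, h2, h3⟩ := exists_eq_of_injOn_window (hinj u) j
    have h5 : u + (w - u) = w := by omega
    have := hPinj (x₁ := 0) (x₂ := w - u + 1) ⟨le_rfl, by omega⟩ ⟨by omega, by omega⟩
      (by simp [P, h5, h3])
    omega

/-- With one unallocated item fewer than there are agents, non-degenerate cancelable
valuations admit a Pareto improvement. -/
lemma improvable_of_le_card_unalloc (hN : 0 < N) (hval : ∀ i, IsValuation (v i))
    (hnd : ∀ i, NonDegenerate (v i)) (hc : ∀ i, Cancelable (v i)) (hX : IsPartialAlloc X)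
    (hEFX : IsEFX v X) (hU : N ≤ (unalloc X).card) : Improvable v X := by
  by_contra hno
  obtain ⟨E, p, hEU, hE, hinj, hper, hch, huniq, hnoenvy⟩ :=
    exists_champion_cycle hN hval hnd hX hEFX hU hno
  let a : Fin (N + 1) := p 0
  let g := E (N + 1)
  have hgX : ∀ i, g ∉ X i := notMem_of_mem_unalloc (hEU _)
  -- the decomposition of every bundle with respect to `g`
  have hdec : ∀ u, ∃ D B : Finset ι, Disjoint D B ∧ X (p u) = D ∪ B ∧
      (∀ k, ¬ StrongEnviesSet v X k (D ∪ {g})) ∧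
      ∀ k, EnviesSet v X k (D ∪ {g}) ↔ k = p (u + 1) := by
    intro u
    obtain ⟨T, hT, hTe, hTn⟩ := hch u (N + 1)
    have hgT : g ∈ T := by
      by_contra hgT
      have hTX : T ⊆ X (p u) := (subset_insert_iff_of_notMem hgT).1 hT
      exact hnoenvy _ _ (lt_of_lt_of_le hTe ((hval _).2.2 hTX))
    have hTX : T.erase g ⊆ X (p u) := by
      intro x hx
      exact (mem_insert.1 (hT (mem_of_mem_erase hx))).resolve_left (ne_of_mem_erase hx)
    have hTeq : T.erase g ∪ {g} = T := by
      rw [union_comm, ← insert_eq, insert_erase hgT]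
    refine ⟨T.erase g, X (p u) \ T.erase g, disjoint_sdiff, (union_sdiff_of_subset hTX).symm,
      ?_, ?_⟩
    · rwa [hTeq]
    · rw [hTeq]
      refine fun k => ⟨fun hk => huniq u (N + 1) k ⟨T, hT, hk, hTn⟩, ?_⟩
      rintro rfl
      exact hTe
  choose D B hDB hXDB hDn hDe using hdec
  have hDX : ∀ u, D u ⊆ X (p u) := fun u => by rw [hXDB u]; exact subset_union_left
  have hBX : ∀ u, B u ⊆ X (p u) := fun u => by rw [hXDB u]; exact subset_union_right
  have hDg : ∀ u, Disjoint (D u) {g} := fun u =>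
    disjoint_singleton_right.2 fun h => hgX _ (hDX u h)
  -- the agents who prefer the discarded part of the bundle of `a` to `g`
  have hend : v (p (N + 1)) {g} < v (p (N + 1)) (B 0) := by
    have hp0 : p (N + 1) = p 0 := by simpa using hper 0
    rw [hp0]
    have hne : p 0 ≠ p 1 := fun h => by
      have := hinj 0 ⟨le_rfl, by omega⟩ ⟨by omega, by omega⟩ h
      omega
    refine (hc (p 0)).lt_of_union_lt (D 0) (hDg 0) (hDB 0) ?_
    rw [← hXDB 0]
    refine lt_of_le_of_ne (not_lt.1 fun h => hne ((hDe 0 (p 0)).1 h)) (hnd _ _ _ fun h => ?_)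
    exact hgX (p 0) (h ▸ mem_union_right _ (mem_singleton_self g))
  have hone : ¬ v (p 1) {g} < v (p 1) (B 0) := by
    refine not_lt.2 (le_of_lt ((hc (p 1)).lt_of_union_lt (D 0) (hDB 0) (hDg 0) ?_))
    rw [← hXDB 0]
    exact lt_of_le_of_lt (not_lt.1 (hnoenvy (p 1) (p 0))) ((hDe 0 (p 1)).2 rfl)
  have hex : ∃ d, 1 ≤ d ∧ v (p d) {g} < v (p d) (B 0) := ⟨N + 1, by omega, hend⟩
  classical
  obtain ⟨d, ⟨hd1, hd⟩, hdmin⟩ : ∃ d, (1 ≤ d ∧ v (p d) {g} < v (p d) (B 0)) ∧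
      ∀ e < d, ¬ (1 ≤ e ∧ v (p e) {g} < v (p e) (B 0)) :=
    ⟨Nat.find hex, Nat.find_spec hex, fun e he => Nat.find_min hex he⟩
  have hdN : d ≤ N + 1 := not_lt.1 fun h => hdmin _ h ⟨by omega, hend⟩
  obtain ⟨c, rfl⟩ : ∃ c, d = c + 1 := ⟨d - 1, by omega⟩
  have hc0 : c ≠ 0 := by
    rintro rfl
    exact hone hd
  have hpc : p c ≠ p 0 := fun h => by
    have := hinj 0 ⟨by omega, by omega⟩ ⟨by omega, by omega⟩ h
    exact hc0 this
  have hDcB : Disjoint (D c) (B 0) := (hX _ _ hpc).mono (hDX c) (hBX 0)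
  have henv : EnviesSet v X (p (c + 1)) (D c ∪ B 0) :=
    lt_of_lt_of_le ((hDe c _).2 rfl) ((hc _).union_le_union _ (hDg c) hDcB hd.le)
  obtain ⟨k, hk⟩ := henv.exists_mostEnvious
  obtain ⟨e, he1, he2, rfl⟩ := exists_eq_of_injOn_window (hinj 1) k
  have hce : c < e := by
    by_contra hec
    have h1 : v (p e) (B 0) ≤ v (p e) {g} :=
      not_lt.1 fun h => hdmin e (by omega) ⟨he1, h⟩
    have h2 : ¬ EnviesSet v X (p e) (D c ∪ {g}) := fun h => by
      have := hinj 1 ⟨by omega, by omega⟩ ⟨by omega, by omega⟩ ((hDe c _).1 h)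
      omega
    obtain ⟨T, hT, hTe, -⟩ := hk
    exact h2 (lt_of_lt_of_le hTe (((hval _).2.2 hT).trans
      ((hc _).union_le_union _ hDcB (hDg c) h1)))
  -- rotate along the cycle `p e, …, p (N + 1 + c)`
  let Z : ℕ → Finset ι := fun u =>
    if u = N + 1 + c then D c ∪ B 0 else if u = N + 1 then D 0 ∪ {g} else {E u} ∪ X (p u)
  have hpN : p (N + 1) = p 0 := by simpa using hper 0
  have hpc' : p (N + 1 + c) = p c := by simpa [add_comm] using hper c
  have hpinj : Set.InjOn p (Set.Icc e (N + 1 + c)) :=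
    (hinj e).mono (Set.Icc_subset_Icc_right (by omega))
  have hZsub : ∀ u, u ≠ N + 1 + c → Z u ⊆ {E u} ∪ X (p u) := by
    intro u hu
    by_cases h : u = N + 1
    · subst h
      simp only [Z, hu, if_false, if_true, hpN]
      rw [union_comm]
      exact union_subset_union_right (hDX 0)
    · simp [Z, hu, h]
  have hElast : ∀ u i, Disjoint {E u} (X i) := fun u i =>
    disjoint_singleton_left.2 (notMem_of_mem_unalloc (hEU u) i)
  have hZlast : Z (N + 1 + c) = D c ∪ B 0 := by simp [Z]
  refine hno (improvable_of_cycle hval hX hEFX (s := e) (r := N + 1 + c) (by omega) p Z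
    hpinj ?_ (hZlast ▸ hk) ?_ ?_)
  · intro u h1 h2
    by_cases h : u = N + 1
    · subst h
      have h3 : Z (N + 1) = D 0 ∪ {g} := by simp [Z, hc0]
      have h4 : p (N + 1 + 1) = p 1 := by simpa [add_comm] using hper 1
      rw [h3, h4]
      exact ⟨_, subset_rfl, (hDe 0 _).2 rfl, hDn 0⟩
    · have h3 : Z u = {E u} ∪ X (p u) := by simp [Z, h, h2.ne]
      rw [h3]
      exact hch u u
  · intro u w h1 h2 h3
    have hne : p u ≠ p w := fun h => by
      have := hpinj ⟨h1, by omega⟩ ⟨by omega, h3⟩ h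
      omega
    rcases h3.eq_or_lt with rfl | h3
    · rw [hZlast]
      rw [hpc'] at hne
      by_cases h : u = N + 1
      · subst h
        have h4 : Z (N + 1) = D 0 ∪ {g} := by simp [Z, hc0]
        rw [h4]
        simp only [disjoint_union_left, disjoint_union_right]
        refine ⟨⟨?_, ?_⟩, hDB 0, ?_⟩
        · exact (hX _ _ hpc.symm).mono (hDX 0) (hDX c)
        · exact (hDg c).symm
        · exact (hElast _ _).mono_right (hBX 0)
      · have hne0 : p u ≠ p 0 := fun h' => by
          rw [← hpN] at h'
          exact h (hpinj ⟨h1, by omega⟩ ⟨by omega, by omega⟩ h')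
        refine Disjoint.mono_left (hZsub u (by omega)) ?_
        simp only [disjoint_union_left, disjoint_union_right]
        exact ⟨⟨(hElast _ _).mono_right (hDX c), (hX _ _ hne).mono_right (hDX c)⟩,
          (hElast _ _).mono_right (hBX 0), (hX _ _ hne0).mono_right (hBX 0)⟩
    · refine Disjoint.mono (hZsub u (by omega)) (hZsub w (by omega)) ?_
      simp only [disjoint_union_left, disjoint_union_right]
      exact ⟨⟨disjoint_singleton.2 (hE u w h2 (by omega)), (hElast _ _).symm⟩, hElast _ _,
        hX _ _ hne⟩
  · intro u i h1 h2 h3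
    rcases h2.eq_or_lt with rfl | h2
    · rw [hZlast]
      have hi : p c ≠ i := hpc' ▸ h3 _ h1 le_rfl
      have hi0 : p 0 ≠ i := hpN ▸ h3 (N + 1) (by omega) (by omega)
      exact disjoint_union_left.2 ⟨(hX _ _ hi).mono_left (hDX c), (hX _ _ hi0).mono_left (hBX 0)⟩
    · exact Disjoint.mono_left (hZsub u h2.ne)
        (disjoint_union_left.2 ⟨hElast _ _, hX _ _ (h3 u h1 h2.le)⟩)

end Cyclic

/-- If `X` is a partial EFX allocation for `n` agents with
non-degenerate cancelable valuations in which at least `n - 1` items are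
unallocated, then some partial EFX allocation `Y` Pareto dominates `X`. -/
theorem efx_pareto_dominating_of_many_unallocated
    {ι : Type*} [DecidableEq ι] [Fintype ι] {n : ℕ} (hn : 2 ≤ n)
    (v : Fin n → Finset ι → ℝ) (hval : ∀ i, IsValuation (v i))
    (hnd : ∀ i, NonDegenerate (v i)) (hc : ∀ i, Cancelable (v i))
    (X : Fin n → Finset ι) (hX : IsPartialAlloc X) (hEFX : IsEFX v X)
    (hU : n - 1 ≤ (unalloc X).card) :
    ∃ Y : Fin n → Finset ι, IsPartialAlloc Y ∧ IsEFX v Y ∧ ParetoDominates v Y X := by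
  obtain ⟨N, rfl⟩ : ∃ N, n = N + 1 := ⟨n - 1, by omega⟩
  exact improvable_of_le_card_unalloc (by omega) hval hnd hc hX hEFX (by simpa using hU)

end FairDivision
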